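/- arXiv:2210.13900 — 3 statements merged into one kernel-verified Lean document; each statement's English description precedes it below -/
import Mathlib

section
/- The B-spline basis functions form a partition of unity on each nonempty knot span: if the knot sequence is nondecreasing, j ≥ p, and t satisfies ξ_j ≤ t < ξ_{j+1} with ξ_j < ξ_{j+1}, then the sum of N_{i,p}(t) over i ranging from j − p to j equals 1. -/
/-- Cox–de Boor recursion for B-spline basis functions over a knot sequence `ξ`.
`bspline ξ p i t` is `N_{i,p}(t)`. Terms with vanishing denominator are taken to be zero. -/
noncomputable def bspline (ξ : ℕ → ℝ) : ℕ → ℕ → ℝ → ℝ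
  | 0, i, t => if ξ i ≤ t ∧ t < ξ (i + 1) then 1 else 0
  | p + 1, i, t =>
      (if ξ (i + p + 1) = ξ i then 0
        else (t - ξ i) / (ξ (i + p + 1) - ξ i) * bspline ξ p i t) +
      (if ξ (i + p + 2) = ξ (i + 1) then 0
        else (ξ (i + p + 2) - t) / (ξ (i + p + 2) - ξ (i + 1)) * bspline ξ p (i + 1) t)


/-- A B-spline basis function vanishes outside its support `[ξ_i, ξ_{i+p+1})`. -/
theorem bspline_eq_zero {ξ : ℕ → ℝ} (hξ : Monotone ξ) (p i : ℕ) (t : ℝ)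
    (h : t < ξ i ∨ ξ (i + p + 1) ≤ t) : bspline ξ p i t = 0 := by
  induction p generalizing i with
  | zero =>
    rw [bspline, if_neg]
    rintro ⟨h₁, h₂⟩
    rcases h with h | h
    · exact absurd h₁ (not_le.mpr h)
    · exact absurd h₂ (not_lt.mpr h)
  | succ p ih =>
    have h₁ : bspline ξ p i t = 0 :=
      ih i (h.imp_right fun h => (hξ (by omega)).trans h)
    have h₂ : bspline ξ p (i + 1) t = 0 :=
      ih (i + 1) (h.imp (fun h => h.trans_le (hξ (by omega)))
        fun h => (hξ (by omega)).trans h)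
    simp [bspline, h₁, h₂]

theorem sum_range_bspline_eq_one {ξ : ℕ → ℝ} (hξ : Monotone ξ) (p k : ℕ) (t : ℝ)
    (ht₁ : ξ (k + p) ≤ t) (ht₂ : t < ξ (k + p + 1)) :
    ∑ m ∈ Finset.range (p + 1), bspline ξ p (k + m) t = 1 := by
  induction p generalizing k with
  | zero =>
    rw [zero_add, Finset.sum_range_one, add_zero, bspline, if_pos ⟨ht₁, ht₂⟩]
  | succ p ih =>
    have hfirst : bspline ξ p k t = 0 := bspline_eq_zero hξ p k t (Or.inr ht₁)
    have hlast : bspline ξ p (k + (p + 1) + 1) t = 0 :=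
      bspline_eq_zero hξ p _ t (Or.inl ht₂)
    have e : k + 1 + p = k + (p + 1) := by omega
    rw [← ih (k + 1) (by rwa [e]) (by rwa [e])]
    simp only [bspline, Finset.sum_add_distrib]
    rw [Finset.sum_range_succ', Finset.sum_range_succ _ (p + 1)]
    simp only [add_zero, hfirst, hlast, mul_zero, ite_self]
    rw [← Finset.sum_add_distrib]
    refine Finset.sum_congr rfl fun m hm => ?_
    have hm' := Finset.mem_range.mp hm
    have hlt : ξ (k + m + 1) < ξ (k + m + p + 2) :=
      (hξ (by omega)).trans_lt ((ht₁.trans_lt ht₂).trans_le (hξ (by omega)))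
    have hne : ξ (k + m + p + 2) - ξ (k + m + 1) ≠ 0 := (sub_pos.mpr hlt).ne'
    rw [show k + (m + 1) + p + 1 = k + m + p + 2 by omega, show k + (m + 1) = k + m + 1 by omega,
      show k + 1 + m = k + m + 1 by omega, if_neg hlt.ne', if_neg hlt.ne']
    field_simp
    ring

/-- Partition of unity: on a nonempty knot span `[ξ_j, ξ_{j+1})` with `j ≥ p`,
the B-spline basis functions of degree `p` sum to one. -/
theorem bspline_partition_of_unity (ξ : ℕ → ℝ) (hξ : Monotone ξ) (p j : ℕ) (hj : p ≤ j)
    (t : ℝ) (ht₁ : ξ j ≤ t) (ht₂ : t < ξ (j + 1)) (hspan : ξ j < ξ (j + 1)) :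
    ∑ i ∈ Finset.Icc (j - p) j, bspline ξ p i t = 1 := by
  obtain ⟨k, rfl⟩ := Nat.exists_eq_add_of_le' hj
  rw [Nat.add_sub_cancel, ← Finset.Ico_add_one_right_eq_Icc, Finset.sum_Ico_eq_sum_range,
    show k + p + 1 - k = p + 1 by omega]
  exact sum_range_bspline_eq_one hξ p k t ht₁ ht₂
end

section
/- The derivative formula for B-splines holds in the interior of each knot span: for a nondecreasing knot sequence, p ≥ 1, and t with ξ_j < t < ξ_{j+1}, the function N_{i,p} is differentiable at t with derivative (p/(ξ_{i+p} − ξ_i)) N_{i,p−1}(t) − (p/(ξ_{i+p+1} − ξ_{i+1})) N_{i+1,p−1}(t), where any term whose denominator is zero is taken to be zero. -/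
/-- The Cox–de Boor recursion with the degenerate cases absorbed by `0⁻¹ = 0`. -/
theorem bspline_succ (ξ : ℕ → ℝ) (p i : ℕ) (t : ℝ) :
    bspline ξ (p + 1) i t =
      (t - ξ i) * (ξ (i + p + 1) - ξ i)⁻¹ * bspline ξ p i t +
      (ξ (i + p + 2) - t) * (ξ (i + p + 2) - ξ (i + 1))⁻¹ * bspline ξ p (i + 1) t := by
  rw [bspline]
  congr 1 <;> split_ifs with h <;> simp [h, div_eq_mul_inv]

/-- In the interior of a knot span the degree-zero B-splines are locally constant. -/
theorem hasDerivAt_bspline_zero (ξ : ℕ → ℝ) (hξ : Monotone ξ) (i j : ℕ)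
    (t : ℝ) (ht₁ : ξ j < t) (ht₂ : t < ξ (j + 1)) :
    HasDerivAt (bspline ξ 0 i) 0 t := by
  have h : bspline ξ 0 i =ᶠ[nhds t] fun _ => if i = j then (1 : ℝ) else 0 := by
    filter_upwards [Ioo_mem_nhds ht₁ ht₂] with s hs
    rw [bspline]
    refine if_congr ⟨fun ⟨h₁, h₂⟩ => ?_, ?_⟩ rfl rfl
    · have h₃ : i < j + 1 := hξ.reflect_lt (h₁.trans_lt hs.2)
      have h₄ : j < i + 1 := hξ.reflect_lt (hs.1.trans h₂)
      omega
    · rintro rfl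
      exact ⟨hs.1.le, hs.2⟩
  exact (hasDerivAt_const t _).congr_of_eventuallyEq h

/-- Differentiating the Cox–de Boor recursion. -/
theorem HasDerivAt.bspline_succ {ξ : ℕ → ℝ} {p i : ℕ} {t d₁ d₂ : ℝ}
    (h₁ : HasDerivAt (bspline ξ p i) d₁ t) (h₂ : HasDerivAt (bspline ξ p (i + 1)) d₂ t) :
    HasDerivAt (bspline ξ (p + 1) i)
      ((ξ (i + p + 1) - ξ i)⁻¹ * (bspline ξ p i t + (t - ξ i) * d₁) +
        (ξ (i + p + 2) - ξ (i + 1))⁻¹ *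
          ((ξ (i + p + 2) - t) * d₂ - bspline ξ p (i + 1) t)) t := by
  have e : bspline ξ (p + 1) i = fun s =>
      (s - ξ i) * (ξ (i + p + 1) - ξ i)⁻¹ * bspline ξ p i s +
      (ξ (i + p + 2) - s) * (ξ (i + p + 2) - ξ (i + 1))⁻¹ * bspline ξ p (i + 1) s :=
    funext (_root_.bspline_succ ξ p i)
  rw [e]
  refine (((((hasDerivAt_id' t).sub_const (ξ i)).mul_const _).fun_mul h₁).fun_add
    ((((hasDerivAt_id' t).const_sub (ξ (i + p + 2))).mul_const _).fun_mul h₂)).congr_deriv ?_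
  ring

/-- The derivative formula with the degenerate cases absorbed by `0⁻¹ = 0`. -/
theorem hasDerivAt_bspline_succ (ξ : ℕ → ℝ) (hξ : Monotone ξ) (p i j : ℕ)
    (t : ℝ) (ht₁ : ξ j < t) (ht₂ : t < ξ (j + 1)) :
    HasDerivAt (bspline ξ (p + 1) i)
      (((p : ℝ) + 1) * ((ξ (i + p + 1) - ξ i)⁻¹ * bspline ξ p i t -
        (ξ (i + p + 2) - ξ (i + 1))⁻¹ * bspline ξ p (i + 1) t)) t := by
  induction p generalizing i with
  | zero =>
    refine ((hasDerivAt_bspline_zero ξ hξ i j t ht₁ ht₂).bspline_succ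
      (hasDerivAt_bspline_zero ξ hξ (i + 1) j t ht₁ ht₂)).congr_deriv ?_
    push_cast
    ring
  | succ p ih =>
    refine ((ih i).bspline_succ (ih (i + 1))).congr_deriv ?_
    have e₁ : i + 1 + p + 1 = i + p + 2 := by omega
    have e₂ : i + 1 + p + 2 = i + p + 3 := by omega
    have e₃ : i + (p + 1) + 1 = i + p + 2 := by omega
    have e₄ : i + (p + 1) + 2 = i + p + 3 := by omega
    have e₅ : i + 1 + 1 = i + 2 := rfl
    simp only [bspline_succ ξ p, e₁, e₂, e₃, e₄, e₅]
    have key : (ξ (i + p + 2) - ξ (i + 1))⁻¹ *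
          ((ξ (i + p + 2) - ξ i)⁻¹ * (ξ (i + p + 2) - ξ i)) =
        (ξ (i + p + 2) - ξ (i + 1))⁻¹ *
          ((ξ (i + p + 3) - ξ (i + 1))⁻¹ * (ξ (i + p + 3) - ξ (i + 1))) := by
      rcases (hξ (show i + 1 ≤ i + p + 2 by omega)).eq_or_lt with h | h
      · simp [h]
      · have h₁ : ξ i ≤ ξ (i + 1) := hξ (by omega)
        have h₂ : ξ (i + p + 2) ≤ ξ (i + p + 3) := hξ (by omega)
        rw [inv_mul_cancel₀ (by linarith : ξ (i + p + 2) - ξ i > 0).ne',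
          inv_mul_cancel₀ (by linarith : ξ (i + p + 3) - ξ (i + 1) > 0).ne']
    push_cast
    linear_combination (-((p : ℝ) + 1) * bspline ξ p (i + 1) t) * key

/-- Derivative formula for B-splines in the interior of a knot span. -/
theorem bspline_hasDerivAt (ξ : ℕ → ℝ) (hξ : Monotone ξ) (i p j : ℕ) (hp : 1 ≤ p)
    (t : ℝ) (ht₁ : ξ j < t) (ht₂ : t < ξ (j + 1)) :
    HasDerivAt (fun s => bspline ξ p i s)
      ((if ξ (i + p) = ξ i then 0
          else (p : ℝ) / (ξ (i + p) - ξ i) * bspline ξ (p - 1) i t) -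
       (if ξ (i + p + 1) = ξ (i + 1) then 0
          else (p : ℝ) / (ξ (i + p + 1) - ξ (i + 1)) * bspline ξ (p - 1) (i + 1) t)) t := by
  obtain ⟨p, rfl⟩ := Nat.exists_eq_add_of_le' hp
  refine (hasDerivAt_bspline_succ ξ hξ p i j t ht₁ ht₂).congr_deriv ?_
  rw [mul_sub, Nat.add_sub_cancel, Nat.cast_succ]
  congr 1 <;> split_ifs with h
  · simp [show ξ (i + p + 1) = ξ i from h]
  · rw [div_eq_mul_inv, mul_assoc, ← add_assoc]
  · simp [show ξ (i + p + 2) = ξ (i + 1) from h]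
  · rw [div_eq_mul_inv, mul_assoc]
    rfl
end

section
/- The NURBS weight function is strictly positive on each nonempty knot span: if the knot sequence is nondecreasing, j ≥ p, t satisfies ξ_j ≤ t < ξ_{j+1} with ξ_j < ξ_{j+1}, and w_i > 0 for all i in the range j − p to j, then W(t) = ∑_{i=j−p}^{j} w_i N_{i,p}(t) > 0. -/
/-- Local support: `N_{i,p}` vanishes outside `[ξ_i, ξ_{i+p+1})`. -/
theorem bspline_support {ξ : ℕ → ℝ} (hξ : Monotone ξ) {p i : ℕ} {t : ℝ}
    (h : bspline ξ p i t ≠ 0) : ξ i ≤ t ∧ t < ξ (i + p + 1) := by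
  induction p generalizing i with
  | zero =>
    by_contra hc
    exact h (if_neg hc)
  | succ p ih =>
    by_cases h₀ : bspline ξ p i t = 0
    · by_cases h₁ : bspline ξ p (i + 1) t = 0
      · simp [bspline, h₀, h₁] at h
      · obtain ⟨hl, hr⟩ := ih h₁
        exact ⟨(hξ (by omega)).trans hl, hr.trans_le (hξ (by omega))⟩
    · obtain ⟨hl, hr⟩ := ih h₀
      exact ⟨hl, hr.trans_le (hξ (by omega))⟩

theorem bspline_nonneg {ξ : ℕ → ℝ} (hξ : Monotone ξ) (p i : ℕ) (t : ℝ) :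
    0 ≤ bspline ξ p i t := by
  induction p generalizing i with
  | zero =>
    rw [bspline]
    split_ifs <;> norm_num
  | succ p ih =>
    rw [bspline]
    refine add_nonneg ?_ ?_
    · split_ifs
      · exact le_rfl
      · rcases eq_or_ne (bspline ξ p i t) 0 with h₀ | h₀
        · simp [h₀]
        · exact mul_nonneg (div_nonneg (sub_nonneg.2 (bspline_support hξ h₀).1)
            (sub_nonneg.2 (hξ (by omega)))) (ih i)
    · split_ifs
      · exact le_rfl
      · rcases eq_or_ne (bspline ξ p (i + 1) t) 0 with h₀ | h₀
        · simp [h₀]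
        · have ht : t < ξ (i + p + 2) := by
            simpa only [show i + 1 + p + 1 = i + p + 2 by omega] using (bspline_support hξ h₀).2
          exact mul_nonneg (div_nonneg (sub_nonneg.2 ht.le)
            (sub_nonneg.2 (hξ (by omega)))) (ih (i + 1))

/-- `N_{i,p}` is positive on the last knot span of its support. -/
theorem bspline_pos_of_mem_last_span {ξ : ℕ → ℝ} (hξ : Monotone ξ) {p i : ℕ} {t : ℝ}
    (hl : ξ (i + p) ≤ t) (hr : t < ξ (i + p + 1)) : 0 < bspline ξ p i t := by
  induction p generalizing i with
  | zero =>
    rw [bspline, if_pos ⟨hl, hr⟩]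
    exact one_pos
  | succ p ih =>
    have hN : 0 < bspline ξ p (i + 1) t :=
      ih (by rwa [show i + 1 + p = i + (p + 1) by omega])
        (by rwa [show i + 1 + p = i + (p + 1) by omega])
    have ht : t < ξ (i + p + 2) := hr
    have hξt : ξ (i + 1) ≤ t := (hξ (by omega)).trans hl
    rw [bspline, if_neg (hξt.trans_lt ht).ne']
    refine add_pos_of_nonneg_of_pos ?_
      (mul_pos (div_pos (sub_pos.2 ht) (sub_pos.2 (hξt.trans_lt ht))) hN)
    split_ifs
    · exact le_rfl
    · exact mul_nonneg (div_nonneg (sub_nonneg.2 ((hξ (by omega)).trans hξt))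
        (sub_nonneg.2 (hξ (by omega)))) (bspline_nonneg hξ p i t)

/-- The NURBS weight function `W(t) = ∑ w_i N_{i,p}(t)` is strictly positive on each
nonempty knot span, provided the weights are positive. -/
theorem nurbs_weight_pos (ξ : ℕ → ℝ) (hξ : Monotone ξ) (p j : ℕ) (hj : p ≤ j)
    (t : ℝ) (ht₁ : ξ j ≤ t) (ht₂ : t < ξ (j + 1)) (hspan : ξ j < ξ (j + 1))
    (w : ℕ → ℝ) (hw : ∀ i ∈ Finset.Icc (j - p) j, 0 < w i) :
    0 < ∑ i ∈ Finset.Icc (j - p) j, w i * bspline ξ p i t := by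
  refine Finset.sum_pos' (fun i hi => mul_nonneg (hw i hi).le (bspline_nonneg hξ p i t)) ?_
  have hmem : j - p ∈ Finset.Icc (j - p) j := Finset.mem_Icc.2 ⟨le_rfl, Nat.sub_le j p⟩
  have hidx : j - p + p = j := Nat.sub_add_cancel hj
  exact ⟨j - p, hmem, mul_pos (hw _ hmem)
    (bspline_pos_of_mem_last_span hξ (by rwa [hidx]) (by rwa [hidx]))⟩
end
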